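/- arXiv:0711.3163 — 2 statements merged into one kernel-verified Lean document; each statement's English description precedes it below -/
import Mathlib

section
/- Let M be a DC-weight sequence and U ⊆ ℝ^n open. Then the polynomials are dense in C^M(U) in the following sense: for every f ∈ C^M(U) and every compact K ⊆ U there exist ρ > 0 and a sequence (P_j) of real polynomial functions on ℝ^n such that ‖f − P_j‖_{ρ,K}^M → 0 as j → ∞. -/
open scoped Nat ENNReal
open Matrix

/-- `f` belongs to the Denjoy–Carleman class `C^M` on the open set `U`. -/
def CMClassOn {E F : Type*} [NormedAddCommGroup E] [NormedSpace ℝ E]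
    [NormedAddCommGroup F] [NormedSpace ℝ F]
    (M : ℕ → ℝ) (U : Set E) (f : E → F) : Prop :=
  ContDiffOn ℝ (⊤ : ℕ∞) f U ∧
    ∀ K : Set E, K ⊆ U → IsCompact K →
      ∃ C > (0 : ℝ), ∃ ρ > (0 : ℝ), ∀ k : ℕ, ∀ x ∈ K,
        ‖iteratedFDerivWithin ℝ k f U x‖ ≤ C * ρ ^ k * (k ! : ℝ) * M k

/-- DC-weight sequence: `M 0 = 1`, positive, increasing, logarithmically convex,
and `sup_k (M (k+1) / M k) ^ (1/k) < ∞`. -/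
def DCWeightSeq (M : ℕ → ℝ) : Prop :=
  M 0 = 1 ∧ (∀ k, 0 < M k) ∧ (∀ k, M k ≤ M (k + 1)) ∧
    (∀ k : ℕ, 1 ≤ k → M k ^ 2 ≤ M (k - 1) * M (k + 1)) ∧
    ∃ C : ℝ, ∀ k : ℕ, 1 ≤ k → (M (k + 1) / M k) ^ ((1 : ℝ) / k) ≤ C

/-- Strong regularity: strong non-quasianalyticity together with moderate growth. -/
def StronglyRegular (N : ℕ → ℝ) : Prop :=
  (∃ C > (0 : ℝ), ∀ j : ℕ,
      ∑' k : ℕ, N (j + k) / (((j + k + 1 : ℕ) : ℝ) * N (j + k + 1)) ≤ C * (N j / N (j + 1))) ∧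
    ∃ C : ℝ, ∀ j k : ℕ, 1 ≤ j → 1 ≤ k →
      (N (j + k) / (N j * N k)) ^ ((1 : ℝ) / ((j : ℝ) + (k : ℝ))) ≤ C

/-- The seminorm `‖f‖_{ρ,K}^M = sup { ‖f^{(k)}(x)‖ / (ρ^k k! M_k) : k ∈ ℕ, x ∈ K }`
(computed in `ℝ≥0∞`; derivatives are taken within `U`). -/
noncomputable def CMNorm {E F : Type*} [NormedAddCommGroup E] [NormedSpace ℝ E]
    [NormedAddCommGroup F] [NormedSpace ℝ F]
    (M : ℕ → ℝ) (ρ : ℝ) (U K : Set E) (f : E → F) : ℝ≥0∞ :=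
  ⨆ (k : ℕ) (x : E) (_ : x ∈ K),
    ENNReal.ofReal (‖iteratedFDerivWithin ℝ k f U x‖ / (ρ ^ k * (k ! : ℝ) * M k))

section PolynomialApproximation

open MeasureTheory Filter Topology Set Function
open scoped Convolution ContDiff

section ConvolutionEstimates

variable {E : Type} [NormedAddCommGroup E] [NormedSpace ℝ E] [FiniteDimensional ℝ E]
  [MeasurableSpace E] [BorelSpace E] {μ : Measure E} [μ.IsAddHaarMeasure]

/-- The derivatives of a convolution are controlled by those of its smooth factor. -/
theorem norm_iteratedFDeriv_convolution_le {V : Type} [NormedAddCommGroup V] [NormedSpace ℝ V]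
    {W : Type} [NormedAddCommGroup W] [NormedSpace ℝ W]
    {Z : Type} [NormedAddCommGroup Z] [NormedSpace ℝ Z] (L : W →L[ℝ] V →L[ℝ] Z)
    {g : E → W} (hg : Integrable g μ) {κ : E → V} (hκ : ContDiff ℝ ∞ κ)
    (hcκ : HasCompactSupport κ) {A : ℝ} (hA : 0 ≤ A) (m : ℕ) {x : E}
    (hb : ∀ t, g t ≠ 0 → ‖iteratedFDeriv ℝ m κ (x - t)‖ ≤ A) :
    ‖iteratedFDeriv ℝ m (g ⋆[L, μ] κ) x‖ ≤ ‖L‖ * A * ∫ t, ‖g t‖ ∂μ := by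
  induction m generalizing V Z with
  | zero =>
    rw [norm_iteratedFDeriv_zero, convolution_def, ← integral_const_mul]
    refine norm_integral_le_of_norm_le (hg.norm.const_mul _) (ae_of_all _ fun t => ?_)
    by_cases ht : g t = 0
    · simp [ht]
    · have := hb t ht
      rw [norm_iteratedFDeriv_zero] at this
      calc ‖L (g t) (κ (x - t))‖ ≤ ‖L‖ * ‖g t‖ * ‖κ (x - t)‖ := L.le_opNorm₂ _ _
        _ ≤ ‖L‖ * ‖g t‖ * A := by gcongr
        _ = ‖L‖ * A * ‖g t‖ := by ring
  | succ m ih =>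
    have hfd : fderiv ℝ (g ⋆[L, μ] κ) = g ⋆[L.precompR E, μ] fderiv ℝ κ := by
      ext1 y
      exact (hcκ.hasFDerivAt_convolution_right L hg.locallyIntegrable
        (hκ.of_le (by exact_mod_cast le_top)) y).fderiv
    rw [← norm_iteratedFDeriv_fderiv, hfd]
    refine (ih (L.precompR E) (hκ.fderiv_right (by simp)) (hcκ.fderiv ℝ) fun t ht => ?_).trans ?_
    · rw [norm_iteratedFDeriv_fderiv]
      exact hb t ht
    · gcongr
      exact ContinuousLinearMap.norm_precompR_le E L

/-- Error estimate for smoothing the cut off function `χ • F` by an approximate identity `κ`. -/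
theorem norm_convolution_sub_le {W : Type} [NormedAddCommGroup W]
    [NormedSpace ℝ W] [CompleteSpace W]
    {χ : E → ℝ} (hχ : ContDiff ℝ ∞ χ) {A : ℝ}
    (hA₀ : ∀ y, ‖χ y‖ ≤ A) (hA₁ : ∀ y, ‖fderiv ℝ χ y‖ ≤ A)
    {κ : E → ℝ} (hκ : ContDiff ℝ ∞ κ) (hcκ : HasCompactSupport κ) (hκ₀ : ∀ z, 0 ≤ κ z)
    (hκ₁ : ∫ z, κ z ∂μ = 1) {δ : ℝ} (hκδ : ∫ z, κ z * ‖z‖ ∂μ ≤ δ) {x : E} (hχx : χ x = 1)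
    {F : E → W} (hF : ContDiff ℝ ∞ F) {B₀ B₁ : ℝ} (hb₀' : ∀ y ∈ tsupport χ, ‖F y‖ ≤ B₀)
    (hb₁' : ∀ y ∈ tsupport χ, ‖fderiv ℝ F y‖ ≤ B₁) :
    ‖((χ • F) ⋆[(ContinuousLinearMap.lsmul ℝ ℝ).flip, μ] κ) x - F x‖ ≤ δ * A * (B₀ + B₁) := by
  have hA : 0 ≤ A := (norm_nonneg _).trans (hA₀ 0)
  have hxs : x ∈ tsupport χ := subset_tsupport _ (by simp [hχx])
  have hb₀ : 0 ≤ B₀ := (norm_nonneg _).trans (hb₀' x hxs)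
  have hb₁ : 0 ≤ B₁ := (norm_nonneg _).trans (hb₁' x hxs)
  have hlip : ∀ y z, ‖χ y • F y - χ z • F z‖ ≤ A * (B₀ + B₁) * ‖y - z‖ := by
    intro y z
    refine Convex.norm_image_sub_le_of_norm_fderiv_le (𝕜 := ℝ) (s := univ)
      (f := fun y => χ y • F y) (fun w _ => ?_) (fun w _ => ?_) convex_univ (mem_univ z)
      (mem_univ y)
    · exact ((hχ.smul hF).differentiable (by simp)) w
    · by_cases hw : w ∈ tsupport χ
      · have h0 := hb₀' w hw
        have h1 := hb₁' w hw
        rw [fderiv_fun_smul (hχ.differentiable (by simp) w) (hF.differentiable (by simp) w)]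
        calc _ ≤ ‖χ w • fderiv ℝ F w‖ + ‖(fderiv ℝ χ w).smulRight (F w)‖ := norm_add_le _ _
          _ = ‖χ w‖ * ‖fderiv ℝ F w‖ + ‖fderiv ℝ χ w‖ * ‖F w‖ := by
            rw [norm_smul, ContinuousLinearMap.norm_smulRight_apply]
          _ ≤ A * B₁ + A * B₀ := by
            gcongr
            exacts [hA₀ w, hA₁ w]
          _ = A * (B₀ + B₁) := by ring
      · have : (fun y => χ y • F y) =ᶠ[𝓝 w] fun _ => 0 := by
          filter_upwards [notMem_tsupport_iff_eventuallyEq.1 hw] with y hy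
          simp [hy]
        rw [this.fderiv_eq]
        simp only [fderiv_fun_const, Pi.zero_apply, norm_zero]
        positivity
  have hint : Integrable κ μ := hκ.continuous.integrable_of_hasCompactSupport hcκ
  have hint' : Integrable (fun z => κ z * ‖z‖) μ :=
    (hκ.continuous.mul continuous_norm).integrable_of_hasCompactSupport hcκ.mul_right
  have hint₁ : Integrable (fun z => κ z • (χ (x - z) • F (x - z))) μ := by
    refine Continuous.integrable_of_hasCompactSupport ?_ hcκ.smul_right
    have := hχ.continuous
    have := hF.continuous
    have := hκ.continuous
    fun_prop
  rw [convolution_eq_swap]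
  simp only [ContinuousLinearMap.flip_apply, ContinuousLinearMap.lsmul_apply, Pi.smul_apply']
  have : F x = ∫ z, κ z • F x ∂μ := by rw [integral_smul_const, hκ₁, one_smul]
  rw [this, ← integral_sub hint₁ (hint.smul_const _)]
  calc _ ≤ ∫ z, A * (B₀ + B₁) * (κ z * ‖z‖) ∂μ := by
        refine norm_integral_le_of_norm_le (hint'.const_mul _) (ae_of_all _ fun z => ?_)
        rw [← smul_sub, norm_smul, Real.norm_of_nonneg (hκ₀ z)]
        have := hlip (x - z) x
        rw [hχx, one_smul, sub_sub_cancel_left, norm_neg] at this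
        calc _ ≤ κ z * (A * (B₀ + B₁) * ‖z‖) := mul_le_mul_of_nonneg_left this (hκ₀ z)
          _ = _ := by ring
    _ = A * (B₀ + B₁) * ∫ z, κ z * ‖z‖ ∂μ := integral_const_mul _ _
    _ ≤ A * (B₀ + B₁) * δ := by gcongr
    _ = _ := by ring

/-- The derivative of a smoothed cut off function. -/
theorem fderiv_smul_convolution_sub {W : Type} [NormedAddCommGroup W]
    [NormedSpace ℝ W] [CompleteSpace W]
    {χ : E → ℝ} (hχ : ContDiff ℝ ∞ χ) (hcχ : HasCompactSupport χ)
    {κ : E → ℝ} (hκi : LocallyIntegrable κ μ) {F : E → W} (hF : ContDiff ℝ ∞ F) :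
    fderiv ℝ (((χ • F) ⋆[(ContinuousLinearMap.lsmul ℝ ℝ).flip, μ] κ) - F) =
      (((χ • fderiv ℝ F) ⋆[(ContinuousLinearMap.lsmul ℝ ℝ).flip, μ] κ) - fderiv ℝ F) +
        ((fun y => (fderiv ℝ χ y).smulRight (F y))
          ⋆[(ContinuousLinearMap.lsmul ℝ ℝ).flip, μ] κ) := by
  have hχ1 : ContDiff ℝ 1 χ := hχ.of_le (by exact_mod_cast le_top)
  have hF1 : ContDiff ℝ 1 F := hF.of_le (by exact_mod_cast le_top)
  have hcχ' := hcχ.fderiv ℝ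
  have hcont' : Continuous (fderiv ℝ χ) := hχ.continuous_fderiv (by simp)
  have hF' : ContDiff ℝ ∞ (fderiv ℝ F) := hF.fderiv_right (by simp)
  let G : E → E →L[ℝ] W := fun y => (fderiv ℝ χ y).smulRight (F y)
  have hGc : Continuous G := by
    have := hF.continuous
    fun_prop
  have hGs : HasCompactSupport G := hcχ'.mono fun y hy => by
    contrapose! hy
    simp only [mem_support, not_not] at hy
    simp [G, hy]
  have hXc : Continuous fun y => χ y • fderiv ℝ F y := hχ.continuous.smul hF'.continuous
  have hXs : HasCompactSupport fun y => χ y • fderiv ℝ F y := hcχ.smul_right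
  ext1 y
  have h1 := HasCompactSupport.hasFDerivAt_convolution_left (μ := μ)
    (ContinuousLinearMap.lsmul ℝ ℝ : ℝ →L[ℝ] W →L[ℝ] W).flip (hcχ.smul_right (f' := F))
    (hχ1.smul hF1) hκi y
  have hL : (ContinuousLinearMap.lsmul ℝ ℝ : ℝ →L[ℝ] W →L[ℝ] W).flip.precompL E =
      (ContinuousLinearMap.lsmul ℝ ℝ : ℝ →L[ℝ] (E →L[ℝ] W) →L[ℝ] (E →L[ℝ] W)).flip := by
    ext u v
    simp
  have hfs : fderiv ℝ (χ • F) = (χ • fderiv ℝ F) + G := by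
    ext1 w
    exact fderiv_smul (hχ.differentiable (by simp) w) (hF.differentiable (by simp) w)
  rw [(h1.sub (hF.differentiable (by simp) y).hasFDerivAt).fderiv, hfs, hL,
    ConvolutionExistsAt.add_distrib]
  · simp only [Pi.add_apply, Pi.sub_apply]
    abel
  · exact hXs.convolutionExists_left _ hXc hκi y
  · exact hGs.convolutionExists_left _ hGc hκi y

/-- Smoothing `χ • F` with an approximate identity `κ` approximates the `k`-th derivative of `F`
wherever `χ = 1` locally, with an error controlled by bounds `b` for the derivatives of `F` on the
support of `χ`. -/
theorem norm_iteratedFDeriv_convolution_sub_le {W : Type} [NormedAddCommGroup W]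
    [NormedSpace ℝ W] [CompleteSpace W]
    {χ : E → ℝ} (hχ : ContDiff ℝ ∞ χ) (hcχ : HasCompactSupport χ) {A : ℝ}
    (hA₀ : ∀ y, ‖χ y‖ ≤ A) (hA₁ : ∀ y, ‖fderiv ℝ χ y‖ ≤ A) (hA₂ : ∫ y, ‖fderiv ℝ χ y‖ ∂μ ≤ A)
    {κ : E → ℝ} (hκ : ContDiff ℝ ∞ κ) (hcκ : HasCompactSupport κ) (hκ₀ : ∀ z, 0 ≤ κ z)
    (hκ₁ : ∫ z, κ z ∂μ = 1) {δ : ℝ} (hκδ : ∫ z, κ z * ‖z‖ ∂μ ≤ δ) {D : ℕ → ℝ} {x : E}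
    (hD₀ : ∀ m, 0 ≤ D m) (hχx : χ x = 1)
    (hD : ∀ m t, fderiv ℝ χ t ≠ 0 → ‖iteratedFDeriv ℝ m κ (x - t)‖ ≤ δ * D m)
    {F : E → W} (hF : ContDiff ℝ ∞ F) {b : ℕ → ℝ}
    (hb : ∀ j, ∀ y ∈ tsupport χ, ‖iteratedFDeriv ℝ j F y‖ ≤ b j) (k : ℕ) :
    ‖iteratedFDeriv ℝ k
        (((χ • F) ⋆[(ContinuousLinearMap.lsmul ℝ ℝ).flip, μ] κ) - F) x‖ ≤
      δ * A * (b k + b (k + 1) + ∑ j ∈ Finset.range k, D (k - 1 - j) * b j) := by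
  have hA : 0 ≤ A := (norm_nonneg _).trans (hA₀ 0)
  have hδ : 0 ≤ δ := (integral_nonneg fun z => mul_nonneg (hκ₀ z) (norm_nonneg z)).trans hκδ
  have hxs : x ∈ tsupport χ := subset_tsupport _ (by simp [hχx])
  induction k generalizing W b with
  | zero =>
    have hb₀ := hb 0
    have hb₁ := hb 1
    simp only [norm_iteratedFDeriv_zero, norm_iteratedFDeriv_one] at hb₀ hb₁
    simpa using norm_convolution_sub_le hχ hA₀ hA₁ hκ hcκ hκ₀ hκ₁ hκδ hχx hF hb₀ hb₁
  | succ k ih =>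
    have hcχ' := hcχ.fderiv ℝ
    have hcont' : Continuous (fderiv ℝ χ) := hχ.continuous_fderiv (by simp)
    have hF' : ContDiff ℝ ∞ (fderiv ℝ F) := hF.fderiv_right (by simp)
    have hκi : LocallyIntegrable κ μ := hκ.continuous.locallyIntegrable
    let G : E → E →L[ℝ] W := fun y => (fderiv ℝ χ y).smulRight (F y)
    have hGc : Continuous G := by
      have := hF.continuous
      fun_prop
    have hGs : HasCompactSupport G := hcχ'.mono fun y hy => by
      contrapose! hy
      simp only [mem_support, not_not] at hy
      simp [G, hy]
    have hGi : Integrable G μ := hGc.integrable_of_hasCompactSupport hGs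
    have hXc : Continuous fun y => χ y • fderiv ℝ F y := hχ.continuous.smul hF'.continuous
    have hfd := fderiv_smul_convolution_sub (μ := μ) hχ hcχ hκi hF
    have hX : ContDiff ℝ ∞ ((χ • fderiv ℝ F) ⋆[(ContinuousLinearMap.lsmul ℝ ℝ).flip, μ] κ) :=
      hcκ.contDiff_convolution_right _ hXc.locallyIntegrable hκ
    have hY : ContDiff ℝ ∞ (G ⋆[(ContinuousLinearMap.lsmul ℝ ℝ).flip, μ] κ) :=
      hcκ.contDiff_convolution_right _ hGc.locallyIntegrable hκ
    have hk : ((k : ℕ) : ℕ∞ω) ≤ (∞ : ℕ∞ω) := by exact_mod_cast le_top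
    have h1 := ih hF' (b := fun j => b (j + 1)) fun j y hy => by
      rw [norm_iteratedFDeriv_fderiv]
      exact hb (j + 1) y hy
    have hGD : ∀ t, G t ≠ 0 → ‖iteratedFDeriv ℝ k κ (x - t)‖ ≤ δ * D k := by
      intro t ht
      refine hD k t fun h => ht ?_
      ext v
      simp [G, h]
    have h2 := norm_iteratedFDeriv_convolution_le
      (ContinuousLinearMap.lsmul ℝ ℝ : ℝ →L[ℝ] (E →L[ℝ] W) →L[ℝ] (E →L[ℝ] W)).flip hGi hκ hcκ
      (mul_nonneg hδ (hD₀ k)) k hGD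
    have hb₀ : 0 ≤ b 0 := (norm_nonneg _).trans (hb 0 x hxs)
    have h3 : ∫ t, ‖G t‖ ∂μ ≤ A * b 0 := by
      have hi : Integrable (fun t => ‖fderiv ℝ χ t‖) μ :=
        (hcont'.integrable_of_hasCompactSupport hcχ').norm
      calc ∫ t, ‖G t‖ ∂μ ≤ ∫ t, ‖fderiv ℝ χ t‖ * b 0 ∂μ := by
            refine integral_mono hGi.norm (hi.mul_const _) fun t => ?_
            simp only [G, ContinuousLinearMap.norm_smulRight_apply]
            by_cases ht : t ∈ tsupport χ
            · have := hb 0 t ht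
              rw [norm_iteratedFDeriv_zero] at this
              gcongr
            · have : fderiv ℝ χ t = 0 :=
                notMem_support.1 fun h => ht (support_fderiv_subset ℝ h)
              simp [this]
        _ = (∫ t, ‖fderiv ℝ χ t‖ ∂μ) * b 0 := integral_mul_const _ _
        _ ≤ A * b 0 := by gcongr
    have h4 : ‖(ContinuousLinearMap.lsmul ℝ ℝ :
        ℝ →L[ℝ] (E →L[ℝ] W) →L[ℝ] (E →L[ℝ] W)).flip‖ ≤ 1 := by
      rw [ContinuousLinearMap.opNorm_flip]
      exact ContinuousLinearMap.opNorm_lsmul_le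
    have hXF : ContDiff ℝ k
        (((χ • fderiv ℝ F) ⋆[(ContinuousLinearMap.lsmul ℝ ℝ).flip, μ] κ) - fderiv ℝ F) :=
      (hX.sub hF').of_le hk
    rw [← norm_iteratedFDeriv_fderiv, hfd]
    change ‖iteratedFDeriv ℝ k
      ((((χ • fderiv ℝ F) ⋆[(ContinuousLinearMap.lsmul ℝ ℝ).flip, μ] κ) - fderiv ℝ F) +
        (G ⋆[(ContinuousLinearMap.lsmul ℝ ℝ).flip, μ] κ)) x‖ ≤ _
    rw [iteratedFDeriv_add_apply hXF.contDiffAt (hY.of_le hk).contDiffAt]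
    refine (norm_add_le _ _).trans ((add_le_add h1 (h2.trans
      (mul_le_mul (mul_le_mul_of_nonneg_right h4 (mul_nonneg hδ (hD₀ k))) h3
        (integral_nonneg fun t => norm_nonneg _)
        (mul_nonneg zero_le_one (mul_nonneg hδ (hD₀ k)))))).trans (le_of_eq ?_))
    rw [Finset.sum_range_succ']
    have : ∀ j ∈ Finset.range k, D (k + 1 - 1 - (j + 1)) * b (j + 1) =
        D (k - 1 - j) * b (j + 1) := fun j _ => by
      rw [show k + 1 - 1 - (j + 1) = k - 1 - j by omega]
    rw [Finset.sum_congr rfl this]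
    simp
    ring

end ConvolutionEstimates

/-- Submultiplicativity of Taylor coefficient norms gives geometric bounds for the derivatives of
the powers of a function. -/
theorem norm_iteratedFDeriv_pow_le {E : Type*} [NormedAddCommGroup E] [NormedSpace ℝ E]
    {p : E → ℝ} (hp : ContDiff ℝ ∞ p) {z : E} {s q : ℝ} (hs : 0 < s)
    (hq : ∀ n, ∑ i ∈ Finset.range (n + 1), ‖iteratedFDeriv ℝ i p z‖ / (i ! : ℝ) * s ^ i ≤ q)
    (N m : ℕ) :
    ‖iteratedFDeriv ℝ m (fun y => p y ^ N) z‖ ≤ q ^ N * (m ! / s ^ m) := by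
  have hq₀ : 0 ≤ q := le_trans (by positivity) (hq 0)
  induction N generalizing m with
  | zero =>
    simp only [pow_zero, one_mul]
    rcases Nat.eq_zero_or_pos m with rfl | hm
    · simp
    · rw [iteratedFDeriv_const_of_ne hm.ne']
      simp only [Pi.zero_apply, norm_zero]
      positivity
  | succ N ih =>
    simp only [pow_succ' (_ : ℝ) N]
    have hpN : ContDiff ℝ ∞ fun y => p y ^ N := hp.pow N
    refine (norm_iteratedFDeriv_mul_le (n := m) (N := ∞) hp hpN z
      (by exact_mod_cast le_top)).trans ?_
    calc _ ≤ ∑ i ∈ Finset.range (m + 1), (‖iteratedFDeriv ℝ i p z‖ / (i ! : ℝ) * s ^ i) *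
          (q ^ N * (m ! / s ^ m)) := by
          refine Finset.sum_le_sum fun i hi => ?_
          have him : i ≤ m := Nat.lt_succ_iff.1 (Finset.mem_range.1 hi)
          calc _ ≤ (m.choose i : ℝ) * ‖iteratedFDeriv ℝ i p z‖ *
                (q ^ N * ((m - i)! / s ^ (m - i))) := by
                gcongr
                exact ih (m - i)
            _ = _ := by
                have h1 : (m.choose i : ℝ) = m ! / (i ! * (m - i)!) := Nat.cast_choose ℝ him
                have h2 : s ^ m = s ^ i * s ^ (m - i) := by rw [← pow_add]; congr 1; omega
                rw [h1, h2]
                have : ((m - i)! : ℝ) ≠ 0 := by positivity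
                field_simp
      _ = (∑ i ∈ Finset.range (m + 1), ‖iteratedFDeriv ℝ i p z‖ / (i ! : ℝ) * s ^ i) *
          (q ^ N * (m ! / s ^ m)) := by rw [Finset.sum_mul]
      _ ≤ q * (q ^ N * (m ! / s ^ m)) := by gcongr; exact hq m
      _ = _ := by ring

/-- Smooth cutoff functions. -/
theorem exists_contDiff_cutoff {E : Type*} [NormedAddCommGroup E] [NormedSpace ℝ E]
    [FiniteDimensional ℝ E] {K U : Set E} (hK : IsCompact K) (hU : IsOpen U) (hKU : K ⊆ U) :
    ∃ χ : E → ℝ, ContDiff ℝ ∞ χ ∧ HasCompactSupport χ ∧ tsupport χ ⊆ U ∧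
      (∀ᶠ x in 𝓝ˢ K, χ x = 1) ∧ ∀ x, 0 ≤ χ x := by
  obtain ⟨L, hL, hKL, hLU⟩ := exists_compact_between hK hU hKU
  obtain ⟨f, hf1, hf0, hf⟩ := exists_contMDiffMap_one_nhds_of_subset_interior
    (n := ((⊤ : ℕ∞))) (modelWithCornersSelf ℝ E) hK.isClosed hKL
  have hsub : tsupport f ⊆ L := closure_minimal (fun x hx => by
    by_contra h
    exact hx (hf0 x h)) hL.isClosed
  exact ⟨f, contMDiff_iff_contDiff.1 f.contMDiff, hL.of_isClosed_subset (isClosed_tsupport _) hsub,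
    hsub.trans hLU, hf1, fun x => (hf x).1⟩

/-- Convolving a polynomial with a compactly supported function yields a polynomial. -/
theorem exists_mvPolynomial_eval_eq_integral {n : ℕ} (P : MvPolynomial (Fin n) ℝ)
    {g : (Fin n → ℝ) → ℝ} (hg : Continuous g) (hcg : HasCompactSupport g) :
    ∃ Q : MvPolynomial (Fin n) ℝ, ∀ x : Fin n → ℝ,
      ∫ y, g y * MvPolynomial.eval (x - y) P = MvPolynomial.eval x Q := by
  have hcont : ∀ P : MvPolynomial (Fin n) ℝ, Continuous fun x => MvPolynomial.eval x P :=
    fun P => MvPolynomial.continuous_eval P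
  have hint : ∀ (P : MvPolynomial (Fin n) ℝ) (g : (Fin n → ℝ) → ℝ), Continuous g →
      HasCompactSupport g → ∀ x, Integrable fun y => g y * MvPolynomial.eval (x - y) P := by
    intro P g hg hcg x
    refine Continuous.integrable_of_hasCompactSupport ?_ hcg.mul_right
    have := hcont P
    fun_prop
  induction P using MvPolynomial.induction_on generalizing g with
  | C a => exact ⟨MvPolynomial.C (∫ y, g y * a), fun x => by simp⟩
  | add p q hp hq =>
    obtain ⟨P₁, h₁⟩ := hp hg hcg
    obtain ⟨P₂, h₂⟩ := hq hg hcg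
    refine ⟨P₁ + P₂, fun x => ?_⟩
    simp only [map_add, mul_add]
    rw [integral_add (hint p g hg hcg x) (hint q g hg hcg x), h₁, h₂]
  | mul_X p i hp =>
    obtain ⟨P₁, h₁⟩ := hp hg hcg
    have hg' : Continuous fun y : Fin n → ℝ => g y * y i := by fun_prop
    have hcg' : HasCompactSupport fun y : Fin n → ℝ => g y * y i := hcg.mul_right
    obtain ⟨P₂, h₂⟩ := hp hg' hcg'
    refine ⟨P₁ * MvPolynomial.X i - P₂, fun x => ?_⟩
    simp only [map_sub, map_mul, MvPolynomial.eval_X]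
    rw [← h₁, ← h₂, ← integral_mul_const,
      ← integral_sub ((hint p g hg hcg x).mul_const _) (hint p _ hg' hcg' x)]
    congr 1
    ext y
    simp only [Pi.sub_apply]
    ring

/-- Powers of a function with vanishing third derivative and strict maximum `1` at the origin, cut
off and normalised, form a good approximate identity. -/
theorem exists_approximate_identity {E : Type*} [NormedAddCommGroup E] [NormedSpace ℝ E]
    [FiniteDimensional ℝ E] [MeasurableSpace E] [BorelSpace E] (μ : Measure E)
    [μ.IsAddHaarMeasure] {p : E → ℝ} (hp : ContDiff ℝ ∞ p) (hp₀ : p 0 = 1)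
    (hp₁ : ∀ z, z ≠ 0 → p z < 1) (hp₃ : ∀ i, 3 ≤ i → ∀ z, iteratedFDeriv ℝ i p z = 0)
    {r R R₁ : ℝ} (hr : 0 < r) (hR : 0 < R) (hRR : R < R₁)
    (hpos : ∀ z ∈ Metric.closedBall (0 : E) R₁, 0 ≤ p z) :
    ∃ s > (0 : ℝ), ∀ δ > (0 : ℝ), ∃ (κ : E → ℝ) (c : ℝ) (N : ℕ), ContDiff ℝ ∞ κ ∧
      HasCompactSupport κ ∧ (∀ z, 0 ≤ κ z) ∧ ∫ z, κ z ∂μ = 1 ∧ ∫ z, κ z * ‖z‖ ∂μ ≤ δ ∧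
      (∀ z, ‖z‖ ≤ R → κ z = c * p z ^ N) ∧
      ∀ m z, r ≤ ‖z‖ → ‖z‖ ≤ R → ‖iteratedFDeriv ℝ m κ z‖ ≤ δ * (m ! / s ^ m) := by
  have : ProperSpace E := FiniteDimensional.proper ℝ E
  obtain ⟨η, hη, hcη, hηs, hη1, hη0⟩ := exists_contDiff_cutoff
    (isCompact_closedBall (0 : E) R) Metric.isOpen_ball (Metric.closedBall_subset_ball hRR)
  rw [eventually_nhdsSet_iff_forall] at hη1
  have hηR : ∀ z, ‖z‖ ≤ R → η =ᶠ[𝓝 z] fun _ => 1 := fun z hz => hη1 z (by simpa using hz)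
  have hηS : ∀ z, z ∉ Metric.closedBall (0 : E) R₁ → η z = 0 := fun z hz => by
    by_contra h
    exact hz (Metric.ball_subset_closedBall (hηs (subset_tsupport _ h)))
  -- uniform bounds away from the origin
  obtain ⟨q, hq₀, hq₁, hq⟩ : ∃ q : ℝ, 0 ≤ q ∧ q < 1 ∧ ∀ z, r ≤ ‖z‖ → ‖z‖ ≤ R → p z ≤ q := by
    have hS : IsCompact (Metric.closedBall (0 : E) R ∩ {z | r ≤ ‖z‖}) :=
      (isCompact_closedBall _ _).inter_right (isClosed_le continuous_const continuous_norm)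
    rcases (Metric.closedBall (0 : E) R ∩ {z | r ≤ ‖z‖}).eq_empty_or_nonempty with he | hne
    · refine ⟨0, le_rfl, one_pos, fun z h1 h2 => ?_⟩
      have : z ∈ Metric.closedBall (0 : E) R ∩ {z | r ≤ ‖z‖} := ⟨by simpa using h2, h1⟩
      simp [he] at this
    · obtain ⟨w, hw, hwmax⟩ := hS.exists_isMaxOn hne hp.continuous.continuousOn
      refine ⟨p w, hpos w (Metric.closedBall_subset_closedBall hRR.le hw.1), hp₁ w fun h => ?_,
        fun z h1 h2 => hwmax ⟨by simpa using h2, h1⟩⟩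
      have := hw.2
      simp only [h, mem_ofPred_eq, norm_zero] at this
      linarith
  obtain ⟨B, hB₀, hB₁, hB₂⟩ : ∃ B : ℝ, 0 ≤ B ∧ (∀ z, ‖z‖ ≤ R → ‖iteratedFDeriv ℝ 1 p z‖ ≤ B) ∧
      ∀ z, ‖z‖ ≤ R → ‖iteratedFDeriv ℝ 2 p z‖ ≤ B := by
    obtain ⟨B₁, h₁⟩ := (isCompact_closedBall (0 : E) R).exists_bound_of_continuousOn
      (hp.continuous_iteratedFDeriv (m := 1) (by exact_mod_cast le_top)).continuousOn
    obtain ⟨B₂, h₂⟩ := (isCompact_closedBall (0 : E) R).exists_bound_of_continuousOn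
      (hp.continuous_iteratedFDeriv (m := 2) (WithTop.coe_le_coe.2 le_top)).continuousOn
    have h0 : (0 : E) ∈ Metric.closedBall (0 : E) R := by simp [hR.le]
    exact ⟨max B₁ B₂, le_max_of_le_left ((norm_nonneg _).trans (h₁ 0 h0)),
      fun z hz => (h₁ z (by simpa using hz)).trans (le_max_left _ _),
      fun z hz => (h₂ z (by simpa using hz)).trans (le_max_right _ _)⟩
  set q₁ := (1 + q) / 2 with hq₁def
  set q₂ := (1 + q₁) / 2 with hq₂def
  have hq₁0 : 0 < q₁ := by positivity
  have hq₂0 : 0 < q₂ := by positivity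
  have hq12 : q₁ < q₂ := by linarith
  have hq2 : q₂ < 1 := by linarith
  obtain ⟨s, hs, hs1, hsB⟩ : ∃ s : ℝ, 0 < s ∧ s ≤ 1 ∧ 2 * B * s ≤ (1 - q) / 2 := by
    refine ⟨min 1 ((1 - q) / (4 * (B + 1))), lt_min one_pos (div_pos (by linarith) (by positivity)),
      min_le_left _ _, ?_⟩
    calc 2 * B * min 1 ((1 - q) / (4 * (B + 1))) ≤ 2 * (B + 1) * ((1 - q) / (4 * (B + 1))) := by
          gcongr
          · linarith
          · exact min_le_right _ _
      _ = (1 - q) / 2 := by field_simp; ring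
  have hsum : ∀ z, r ≤ ‖z‖ → ‖z‖ ≤ R → ∀ n,
      ∑ i ∈ Finset.range (n + 1), ‖iteratedFDeriv ℝ i p z‖ / (i ! : ℝ) * s ^ i ≤ q₁ := by
    intro z h1 h2 n
    calc _ ≤ ∑ i ∈ Finset.range (3 + n), ‖iteratedFDeriv ℝ i p z‖ / (i ! : ℝ) * s ^ i :=
          Finset.sum_le_sum_of_subset_of_nonneg (Finset.range_mono (by omega))
            fun i _ _ => by positivity
      _ = ∑ i ∈ Finset.range 3, ‖iteratedFDeriv ℝ i p z‖ / (i ! : ℝ) * s ^ i := by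
          rw [Finset.sum_range_add, Finset.sum_eq_zero (s := Finset.range n), add_zero]
          intro i _
          rw [hp₃ (3 + i) (by omega) z]
          simp
      _ = p z + ‖iteratedFDeriv ℝ 1 p z‖ * s + ‖iteratedFDeriv ℝ 2 p z‖ / 2 * s ^ 2 := by
          rw [Finset.sum_range_succ, Finset.sum_range_succ, Finset.sum_range_one,
            norm_iteratedFDeriv_zero, Real.norm_of_nonneg
              (hpos z (by simpa using h2.trans hRR.le))]
          simp
      _ ≤ q + B * s + B * s := by
          have e1 := hB₁ z h2
          have e2 := hB₂ z h2
          have e3 : ‖iteratedFDeriv ℝ 2 p z‖ / 2 * s ^ 2 ≤ B * s := by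
            have : s ^ 2 ≤ s := by nlinarith
            have := norm_nonneg (iteratedFDeriv ℝ 2 p z)
            calc _ ≤ B * s ^ 2 := by gcongr; linarith
              _ ≤ B * s := by gcongr
          have := hq z h1 h2
          gcongr
      _ ≤ q₁ := by rw [hq₁def]; linarith
  -- the integrals
  have hcont : ∀ N, Continuous fun z => η z * p z ^ N := fun N =>
    hη.continuous.mul (hp.continuous.pow N)
  have hint : ∀ N, Integrable (fun z => η z * p z ^ N) μ := fun N =>
    (hcont N).integrable_of_hasCompactSupport hcη.mul_right
  have hnn : ∀ N z, 0 ≤ η z * p z ^ N := fun N z => by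
    by_cases hz : z ∈ Metric.closedBall (0 : E) R₁
    · exact mul_nonneg (hη0 z) (pow_nonneg (hpos z hz) N)
    · simp [hηS z hz]
  set I : ℕ → ℝ := fun N => ∫ z, η z * p z ^ N ∂μ with hI
  obtain ⟨v, hv, hIv⟩ : ∃ v > 0, ∀ N, v * q₂ ^ N ≤ I N := by
    set u : Set E := Metric.ball 0 R ∩ {z | q₂ < p z} with hu
    have huo : IsOpen u := Metric.isOpen_ball.inter (isOpen_lt continuous_const hp.continuous)
    have hu0 : (0 : E) ∈ u := ⟨by simpa using hR, by simpa [hp₀] using hq2⟩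
    have hufin : μ u ≠ ⊤ :=
      ((measure_mono inter_subset_left).trans_lt Metric.isBounded_ball.measure_lt_top).ne
    refine ⟨μ.real u, ENNReal.toReal_pos (huo.measure_pos μ ⟨0, hu0⟩).ne' hufin, fun N => ?_⟩
    calc μ.real u * q₂ ^ N ≤ ∫ z in u, η z * p z ^ N ∂μ := by
          refine setIntegral_ge_of_const_le huo.measurableSet hufin (fun z hz => ?_)
            (hint N).integrableOn
          have h1 : η z = 1 := (hηR z (by simpa using (Metric.ball_subset_closedBall hz.1))).eq_of_nhds
          have h2 : q₂ < p z := hz.2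
          rw [h1, one_mul]
          gcongr
      _ ≤ I N := setIntegral_le_integral (hint N) (ae_of_all _ (hnn N))
  have hIpos : ∀ N, 0 < I N := fun N => (by positivity : 0 < v * q₂ ^ N).trans_le (hIv N)
  have hlim1 : Tendsto (fun N => (I N)⁻¹ * q₁ ^ N) atTop (𝓝 0) := by
    have h0 : Tendsto (fun N => v⁻¹ * (q₁ / q₂) ^ N) atTop (𝓝 (v⁻¹ * 0)) :=
      (tendsto_pow_atTop_nhds_zero_of_lt_one (by positivity)
        ((div_lt_one hq₂0).2 hq12)).const_mul _
    rw [mul_zero] at h0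
    refine squeeze_zero (fun N => mul_nonneg (inv_nonneg.2 (hIpos N).le) (by positivity))
      (fun N => ?_) h0
    calc (I N)⁻¹ * q₁ ^ N ≤ (v * q₂ ^ N)⁻¹ * q₁ ^ N := by
          gcongr
          exact hIv N
      _ = v⁻¹ * (q₁ / q₂) ^ N := by rw [div_pow q₁ q₂, mul_inv, mul_assoc, mul_comm (q₂ ^ N)⁻¹, ← div_eq_mul_inv]
  have hpeak : ∀ g : E → ℝ, Continuous g → Tendsto (fun N : ℕ =>
      (∫ z in Metric.closedBall (0 : E) R₁, p z ^ N ∂μ)⁻¹ * ∫ z, η z * p z ^ N * g z ∂μ)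
      atTop (𝓝 (g 0)) := by
    intro g hg
    have h := tendsto_setIntegral_pow_smul_of_unique_maximum_of_isCompact_of_continuousOn (μ := μ)
      (isCompact_closedBall (0 : E) R₁) hp.continuous.continuousOn (x₀ := 0)
      (fun y _ hy => by rw [hp₀]; exact hp₁ y hy) hpos (by rw [hp₀]; exact one_pos)
      (subset_closure (Metric.ball_subset_interior_closedBall
        (Metric.mem_ball_self (hR.trans hRR)))) (g := fun z => η z * g z)
      (hη.continuous.mul hg).continuousOn
    have h1 : η 0 = 1 := (hηR 0 (by simpa using hR.le)).eq_of_nhds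
    rw [h1, one_mul] at h
    refine h.congr fun N => ?_
    rw [smul_eq_mul, ← setIntegral_eq_integral_of_forall_compl_eq_zero
      (s := Metric.closedBall (0 : E) R₁) (f := fun z => η z * p z ^ N * g z)
      fun z hz => by simp [hηS z hz]]
    congr 2
    ext z
    rw [smul_eq_mul]
    ring
  have hlim2 : Tendsto (fun N => (I N)⁻¹ * ∫ z, η z * p z ^ N * ‖z‖ ∂μ) atTop (𝓝 0) := by
    have h1 := hpeak (fun _ => 1) continuous_const
    have h2 := hpeak (fun z => ‖z‖) continuous_norm
    have h3 := h2.div h1 one_ne_zero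
    simp only [norm_zero, zero_div] at h3
    refine h3.congr' ?_
    filter_upwards [h1.eventually_ne one_ne_zero] with N hN
    have hS : (∫ z in Metric.closedBall (0 : E) R₁, p z ^ N ∂μ)⁻¹ ≠ 0 := left_ne_zero_of_mul hN
    simp only [Pi.div_apply, mul_one]
    rw [mul_div_mul_left _ _ hS, div_eq_inv_mul]
  refine ⟨s, hs, fun δ hδ => ?_⟩
  obtain ⟨N, hN1, hN2⟩ := ((hlim1.eventually_lt_const hδ).and (hlim2.eventually_lt_const hδ)).exists
  have hκR : ∀ z, ‖z‖ ≤ R →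
      (fun z => (I N)⁻¹ * (η z * p z ^ N)) =ᶠ[𝓝 z] (I N)⁻¹ • fun z => p z ^ N := fun z hz => by
    filter_upwards [hηR z hz] with y hy
    simp [hy]
  refine ⟨fun z => (I N)⁻¹ * (η z * p z ^ N), (I N)⁻¹, N, contDiff_const.mul (hη.mul (hp.pow N)),
    hcη.mul_right.mul_left, fun z => mul_nonneg (inv_nonneg.2 (hIpos N).le) (hnn N z), ?_, ?_,
    fun z hz => ?_, fun m z h1 h2 => ?_⟩
  · rw [integral_const_mul]
    exact inv_mul_cancel₀ (hIpos N).ne'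
  · simp only [mul_assoc (I N)⁻¹]
    rw [integral_const_mul]
    exact hN2.le
  · exact (hκR z hz).eq_of_nhds
  · rw [((hκR z h2).iteratedFDeriv ℝ m).eq_of_nhds, iteratedFDeriv_const_smul_apply
      (((hp.pow N).of_le (by exact_mod_cast le_top)).contDiffAt), norm_smul,
      Real.norm_of_nonneg (inv_nonneg.2 (hIpos N).le)]
    calc (I N)⁻¹ * ‖iteratedFDeriv ℝ m (fun z => p z ^ N) z‖ ≤
          (I N)⁻¹ * (q₁ ^ N * (m ! / s ^ m)) := by
          have := (hIpos N).le
          gcongr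
          exact norm_iteratedFDeriv_pow_le hp hs (hsum z h1 h2) N m
      _ = (I N)⁻¹ * q₁ ^ N * (m ! / s ^ m) := by ring
      _ ≤ δ * (m ! / s ^ m) := by gcongr

/-- The third and higher derivatives of a quadratic polynomial vanish. -/
theorem iteratedFDeriv_one_sub_sum_sq_eq_zero {n : ℕ} (T : ℝ) {i : ℕ} (hi : 3 ≤ i)
    (z : Fin n → ℝ) :
    iteratedFDeriv ℝ i (fun z : Fin n → ℝ => 1 - T * ∑ l, z l ^ 2) z = 0 := by
  set ℓ : (Fin n → ℝ) →L[ℝ] (Fin n → ℝ) →L[ℝ] ℝ :=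
    ∑ l, (ContinuousLinearMap.proj l : (Fin n → ℝ) →L[ℝ] ℝ).smulRight
      ((-(2 * T)) • (ContinuousLinearMap.proj l : (Fin n → ℝ) →L[ℝ] ℝ)) with hℓ
  have h1 : fderiv ℝ (fun z : Fin n → ℝ => 1 - T * ∑ l, z l ^ 2) = ℓ := by
    ext1 w
    have h : ∀ l, HasFDerivAt (fun z : Fin n → ℝ => z l)
        (ContinuousLinearMap.proj l : (Fin n → ℝ) →L[ℝ] ℝ) w := fun l =>
      (ContinuousLinearMap.proj l : (Fin n → ℝ) →L[ℝ] ℝ).hasFDerivAt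
    have h' := ((HasFDerivAt.fun_sum fun l (_ : l ∈ Finset.univ) => (h l).pow 2).const_mul
      T).const_sub 1
    rw [h'.fderiv]
    ext v
    simp only [hℓ, _root_.neg_apply, _root_.smul_apply,
      _root_.sum_apply, ContinuousLinearMap.proj_apply, smul_eq_mul,
      ContinuousLinearMap.smulRight_apply, Finset.mul_sum, ← Finset.sum_neg_distrib]
    refine Finset.sum_congr rfl fun l _ => ?_
    simp
    ring
  have h2 : fderiv ℝ ℓ = fun _ => ℓ := by
    ext1 w
    exact ℓ.fderiv
  obtain ⟨k, rfl⟩ := Nat.exists_eq_add_of_le' hi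
  rw [← norm_eq_zero, show k + 3 = k + 1 + 1 + 1 from rfl, ← norm_iteratedFDeriv_fderiv, h1,
    ← norm_iteratedFDeriv_fderiv, h2, iteratedFDeriv_const_of_ne (Nat.succ_ne_zero k)]
  simp

/-- Stability of Denjoy–Carleman bounds under the operations occurring in the smoothing error. -/
theorem DCWeightSeq.exists_bound_smoothing_error {M : ℕ → ℝ} (hM : DCWeightSeq M) {C ρ s : ℝ}
    (hC : 0 < C) (hρ : 0 < ρ) (hs : 0 < s) :
    ∃ C' > (0 : ℝ), ∃ σ > (0 : ℝ), ∀ k : ℕ,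
      C * ρ ^ k * (k ! : ℝ) * M k + C * ρ ^ (k + 1) * ((k + 1)! : ℝ) * M (k + 1) +
        ∑ j ∈ Finset.range k, ((k - 1 - j)! / s ^ (k - 1 - j)) * (C * ρ ^ j * (j ! : ℝ) * M j) ≤
      C' * (σ ^ k * (k ! : ℝ) * M k) := by
  obtain ⟨h0, hpos, hmono, -, C₀, hC₀⟩ := hM
  set H := max 1 C₀ with hH
  set τ := max 1 (max ρ s⁻¹) with hτ
  have hH1 : 1 ≤ H := le_max_left _ _
  have hτ1 : 1 ≤ τ := le_max_left _ _
  have hρτ : ρ ≤ τ := (le_max_left _ _).trans (le_max_right _ _)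
  have hsτ : s⁻¹ ≤ τ := (le_max_right _ _).trans (le_max_right _ _)
  have hM1 := hpos 1
  have hML : 1 ≤ M 1 := h0 ▸ hmono 0
  have hmon : Monotone M := monotone_nat_of_le_succ hmono
  have hratio : ∀ k, M (k + 1) ≤ M 1 * H ^ k * M k := by
    intro k
    rcases Nat.eq_zero_or_pos k with rfl | hk
    · simp [h0]
    · have h1 : 0 ≤ M (k + 1) / M k := (div_pos (hpos _) (hpos _)).le
      have h2 : M (k + 1) / M k ≤ H ^ k := by
        calc M (k + 1) / M k = ((M (k + 1) / M k) ^ ((1 : ℝ) / k)) ^ k := by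
              rw [one_div, Real.rpow_inv_natCast_pow h1 hk.ne']
          _ ≤ H ^ k := by
              gcongr
              exact (hC₀ k hk).trans (le_max_right _ _)
      have := (div_le_iff₀ (hpos k)).1 h2
      calc M (k + 1) ≤ 1 * (H ^ k * M k) := by rwa [one_mul]
        _ ≤ M 1 * (H ^ k * M k) := by
            have := (hpos k).le
            gcongr
        _ = _ := by ring
  refine ⟨C + C * τ * M 1 + C, by positivity, 2 * H * τ, by positivity, fun k => ?_⟩
  have hMk := hpos k
  have hτσ : τ ^ k ≤ (2 * H * τ) ^ k := by
    gcongr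
    nlinarith
  have e1 : C * ρ ^ k * (k ! : ℝ) * M k ≤ C * ((2 * H * τ) ^ k * (k ! : ℝ) * M k) := by
    calc _ ≤ C * τ ^ k * (k ! : ℝ) * M k := by gcongr
      _ ≤ C * (2 * H * τ) ^ k * (k ! : ℝ) * M k := by gcongr
      _ = _ := by ring
  have e2 : C * ρ ^ (k + 1) * ((k + 1)! : ℝ) * M (k + 1) ≤
      C * τ * M 1 * ((2 * H * τ) ^ k * (k ! : ℝ) * M k) := by
    have hk2 : ((k + 1 : ℕ) : ℝ) ≤ 2 ^ k := by exact_mod_cast Nat.lt_two_pow_self (n := k)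
    calc _ ≤ C * τ ^ (k + 1) * ((k + 1)! : ℝ) * (M 1 * H ^ k * M k) := by
          have := (hpos (k + 1)).le
          gcongr
          exact hratio k
      _ = C * τ ^ (k + 1) * (((k + 1 : ℕ) : ℝ) * (k ! : ℝ)) * (M 1 * H ^ k * M k) := by
          rw [Nat.factorial_succ]; push_cast; ring
      _ ≤ C * τ ^ (k + 1) * (2 ^ k * (k ! : ℝ)) * (M 1 * H ^ k * M k) := by gcongr
      _ = _ := by rw [mul_pow, mul_pow]; ring
  have e3 : ∑ j ∈ Finset.range k, ((k - 1 - j)! / s ^ (k - 1 - j)) * (C * ρ ^ j * (j ! : ℝ) * M j) ≤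
      C * ((2 * H * τ) ^ k * (k ! : ℝ) * M k) := by
    rcases k with _ | k
    · simp only [Finset.range_zero, Finset.sum_empty]
      positivity
    calc _ ≤ ∑ j ∈ Finset.range (k + 1), C * τ ^ k * (k ! : ℝ) * M (k + 1) := by
          refine Finset.sum_le_sum fun j hj => ?_
          have hjk : j ≤ k := Nat.lt_succ_iff.1 (Finset.mem_range.1 hj)
          have hf : ((k - j)! : ℝ) * (j ! : ℝ) ≤ (k ! : ℝ) := by
            have := Nat.factorial_mul_factorial_dvd_factorial hjk
            have := Nat.le_of_dvd (Nat.factorial_pos k) this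
            rw [mul_comm]
            exact_mod_cast this
          have hMj := hmon (show j ≤ k + 1 by omega)
          have := (hpos j).le
          rw [show k + 1 - 1 - j = k - j by omega, div_eq_mul_inv, ← inv_pow]
          calc _ ≤ ((k - j)! * τ ^ (k - j)) * (C * τ ^ j * (j ! : ℝ) * M (k + 1)) := by gcongr
            _ = C * (τ ^ (k - j) * τ ^ j) * ((k - j)! * (j ! : ℝ)) * M (k + 1) := by ring
            _ ≤ C * τ ^ k * (k ! : ℝ) * M (k + 1) := by
              rw [← pow_add, show k - j + j = k by omega]
              gcongr
      _ = C * τ ^ k * ((k + 1)! : ℝ) * M (k + 1) := by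
          rw [Finset.sum_const, Finset.card_range, nsmul_eq_mul, Nat.factorial_succ]
          push_cast
          ring
      _ ≤ C * (2 * H * τ) ^ (k + 1) * ((k + 1)! : ℝ) * M (k + 1) := by
          have : τ ^ k ≤ (2 * H * τ) ^ (k + 1) :=
            (pow_le_pow_right₀ hτ1 (Nat.le_succ k)).trans hτσ
          gcongr
      _ = _ := by ring
  linarith

/-- A smooth function on an open set agrees near a given compact subset with a globally smooth
function. -/
theorem ContDiffOn.exists_contDiff_eventuallyEq {E W : Type*} [NormedAddCommGroup E]
    [NormedSpace ℝ E] [FiniteDimensional ℝ E] [NormedAddCommGroup W] [NormedSpace ℝ W]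
    {L U : Set E} {f : E → W} (hf : ContDiffOn ℝ ∞ f U) (hL : IsCompact L) (hU : IsOpen U)
    (hLU : L ⊆ U) : ∃ F : E → W, ContDiff ℝ ∞ F ∧ ∀ x ∈ L, F =ᶠ[𝓝 x] f := by
  obtain ⟨χ, hχ, -, hχU, hχ1, -⟩ := exists_contDiff_cutoff hL hU hLU
  rw [eventually_nhdsSet_iff_forall] at hχ1
  refine ⟨fun x => χ x • f x, contDiff_iff_contDiffAt.2 fun x => ?_, fun x hx => ?_⟩
  · by_cases hx : x ∈ U
    · exact hχ.contDiffAt.smul (hf.contDiffAt (hU.mem_nhds hx))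
    · refine contDiffAt_const (c := (0 : W)) |>.congr_of_eventuallyEq ?_
      filter_upwards [notMem_tsupport_iff_eventuallyEq.1 fun h => hx (hχU h)] with y hy
      simp [hy]
  · filter_upwards [hχ1 x hx] with y hy
    simp [hy]

/-- Functions of Denjoy–Carleman class are approximated on compact sets, together with all their
derivatives, by polynomials. -/
theorem CMClassOn.exists_mvPolynomial_norm_iteratedFDerivWithin_sub_le {n : ℕ} {M : ℕ → ℝ}
    (hM : DCWeightSeq M) {U : Set (Fin n → ℝ)} (hU : IsOpen U) {f : (Fin n → ℝ) → ℝ}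
    (hf : CMClassOn M U f) {K : Set (Fin n → ℝ)} (hK : IsCompact K) (hKU : K ⊆ U) :
    ∃ σ > (0 : ℝ), ∃ B > (0 : ℝ), ∀ δ > (0 : ℝ), ∃ P : MvPolynomial (Fin n) ℝ, ∀ k : ℕ, ∀ x ∈ K,
      ‖iteratedFDerivWithin ℝ k (f - fun y => MvPolynomial.eval y P) U x‖ ≤
        δ * B * (σ ^ k * (k ! : ℝ) * M k) := by
  obtain ⟨χ, hχ, hcχ, hχU, hχ1, -⟩ := exists_contDiff_cutoff hK hU hKU
  obtain ⟨F, hF, hFf⟩ := hf.1.exists_contDiff_eventuallyEq hcχ hU hχU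
  obtain ⟨C, hC, ρ, hρ, hfC⟩ := hf.2 (tsupport χ) hχU hcχ
  have hFC : ∀ k, ∀ x ∈ tsupport χ, ‖iteratedFDeriv ℝ k F x‖ ≤ C * ρ ^ k * (k ! : ℝ) * M k := by
    intro k x hx
    rw [((hFf x hx).iteratedFDeriv ℝ k).eq_of_nhds,
      ← iteratedFDerivWithin_of_isOpen k hU (hχU hx)]
    exact hfC k x hx
  -- the derivative of the cutoff vanishes near `K`
  obtain ⟨r, hr, hrK⟩ : ∃ r > 0, ∀ x ∈ K, ∀ t, fderiv ℝ χ t ≠ 0 → r ≤ ‖x - t‖ := by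
    obtain ⟨V, hV, hKV, hV1⟩ := eventually_nhdsSet_iff_exists.1 hχ1
    obtain ⟨r, hr, hrV⟩ := hK.exists_thickening_subset_open hV hKV
    refine ⟨r, hr, fun x hx t ht => ?_⟩
    by_contra! h
    refine ht ?_
    have htV : t ∈ V := hrV (Metric.mem_thickening_iff.2 ⟨x, hx, by rwa [dist_comm, dist_eq_norm]⟩)
    have : χ =ᶠ[𝓝 t] fun _ => 1 := by
      filter_upwards [hV.mem_nhds htV] with y hy using hV1 y hy
    rw [this.fderiv_eq]
    simp
  obtain ⟨R₀, hR₀, hKL⟩ := (hK.union hcχ).isBounded.subset_ball_lt 0 0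
  have hdist : ∀ y ∈ Metric.ball (0 : Fin n → ℝ) R₀, ∀ t ∈ tsupport χ, ‖y - t‖ ≤ 2 * R₀ := by
    intro y hy t ht
    have h1 : ‖y‖ < R₀ := by simpa using hy
    have h2 : ‖t‖ < R₀ := by simpa using hKL (Or.inr ht)
    linarith [norm_sub_le y t]
  obtain ⟨A, hA, hA₀, hA₁, hA₂⟩ : ∃ A > 0, (∀ y, ‖χ y‖ ≤ A) ∧ (∀ y, ‖fderiv ℝ χ y‖ ≤ A) ∧
      ∫ y, ‖fderiv ℝ χ y‖ ≤ A := by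
    obtain ⟨A₀, h₀⟩ := hcχ.exists_bound_of_continuous hχ.continuous
    obtain ⟨A₁, h₁⟩ := (hcχ.fderiv ℝ).exists_bound_of_continuous
      (hχ.continuous_fderiv (by simp))
    exact ⟨max (max A₀ A₁) (max (∫ y, ‖fderiv ℝ χ y‖) 1), by positivity,
      fun y => (h₀ y).trans (le_max_of_le_left (le_max_left _ _)),
      fun y => (h₁ y).trans (le_max_of_le_left (le_max_right _ _)),
      le_max_of_le_right (le_max_left _ _)⟩
  -- the peaked quadratic polynomial
  set T : ℝ := n * (2 * R₀ + 1) ^ 2 + 1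
  have hT : 0 < T := by positivity
  set p : (Fin n → ℝ) → ℝ := fun z => 1 - T⁻¹ * ∑ l, z l ^ 2
  have hp₁ : ∀ z, z ≠ 0 → p z < 1 := by
    intro z hz
    obtain ⟨l, hl⟩ := Function.ne_iff.1 hz
    have : 0 < ∑ l, z l ^ 2 := Finset.sum_pos' (fun _ _ => sq_nonneg _)
      ⟨l, Finset.mem_univ l, by simpa using sq_pos_of_ne_zero hl⟩
    have : 0 < T⁻¹ * ∑ l, z l ^ 2 := by positivity
    change 1 - T⁻¹ * ∑ l, z l ^ 2 < 1
    linarith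
  have hpos : ∀ z ∈ Metric.closedBall (0 : Fin n → ℝ) (2 * R₀ + 1), 0 ≤ p z := by
    intro z hz
    have hz' : ‖z‖ ≤ 2 * R₀ + 1 := by simpa using hz
    have h : ∑ l, z l ^ 2 ≤ T := by
      calc ∑ l, z l ^ 2 ≤ ∑ _l : Fin n, (2 * R₀ + 1) ^ 2 := by
            refine Finset.sum_le_sum fun l _ => ?_
            rw [← sq_abs]
            have := (norm_le_pi_norm z l).trans hz'
            rw [Real.norm_eq_abs] at this
            gcongr
        _ ≤ T := by simp [T]
    have : T⁻¹ * ∑ l, z l ^ 2 ≤ 1 := by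
      rw [inv_mul_le_iff₀ hT]
      simpa using h
    change 0 ≤ 1 - T⁻¹ * ∑ l, z l ^ 2
    linarith
  have hp : ContDiff ℝ ∞ p := by fun_prop
  obtain ⟨s, hs, hker⟩ := exists_approximate_identity volume hp (by simp [p]) hp₁
    (fun i hi z => iteratedFDeriv_one_sub_sum_sq_eq_zero T⁻¹ hi z) hr
    (show 0 < 2 * R₀ by positivity) (lt_add_one _) hpos
  obtain ⟨C', hC', σ, hσ, hbound⟩ := hM.exists_bound_smoothing_error hC hρ hs
  refine ⟨σ, hσ, A * C', by positivity, fun δ hδ => ?_⟩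
  obtain ⟨κ, c, N, hκ, hcκ, hκ₀, hκ₁, hκδ, hκp, hκD⟩ := hker δ hδ
  have hχF : Continuous (χ • F) := hχ.continuous.smul hF.continuous
  obtain ⟨Q, hQ⟩ := exists_mvPolynomial_eval_eq_integral
    (MvPolynomial.C c * (1 - MvPolynomial.C T⁻¹ * ∑ l, MvPolynomial.X l ^ 2) ^ N) hχF
    hcχ.smul_right
  refine ⟨Q, fun k x hx => ?_⟩
  have hxL : x ∈ tsupport χ := by
    refine subset_tsupport _ ?_
    rw [Function.mem_support, (eventually_nhdsSet_iff_forall.1 hχ1 x hx).self_of_nhds]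
    exact one_ne_zero
  have hfQ : f - (fun y => MvPolynomial.eval y Q) =ᶠ[𝓝 x]
      -(((χ • F) ⋆[(ContinuousLinearMap.lsmul ℝ ℝ).flip, volume] κ) - F) := by
    filter_upwards [hFf x hxL, Metric.isOpen_ball.mem_nhds (hKL (Or.inl hx))] with y hy hyR
    simp only [Pi.sub_apply, Pi.neg_apply, neg_sub, hy]
    rw [← hQ y, convolution_def]
    congr 1
    refine integral_congr_ae (ae_of_all _ fun t => ?_)
    by_cases ht : t ∈ tsupport χ
    · simp [hκp _ (hdist y hyR t ht), p, mul_comm]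
    · simp [image_eq_zero_of_notMem_tsupport ht]
  rw [iteratedFDerivWithin_of_isOpen k hU (hKU hx), (hfQ.iteratedFDeriv ℝ k).eq_of_nhds,
    iteratedFDeriv_neg_apply, norm_neg]
  refine (norm_iteratedFDeriv_convolution_sub_le hχ hcχ hA₀ hA₁ hA₂ hκ hcκ hκ₀ hκ₁ hκδ
    (D := fun m => m ! / s ^ m) (fun m => by positivity)
    (eventually_nhdsSet_iff_forall.1 hχ1 x hx).self_of_nhds
    (fun m t ht => hκD m _ (hrK x hx t ht) (hdist x (hKL (Or.inl hx)) t
      (support_fderiv_subset ℝ ht))) hF hFC k).trans ?_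
  calc _ ≤ δ * A * (C' * (σ ^ k * (k ! : ℝ) * M k)) := by
        gcongr
        exact hbound k
    _ = _ := by ring

end PolynomialApproximation

/-- Polynomials are dense in `C^M(U)`: for `f ∈ C^M(U)` and compact
`K ⊆ U` there are `ρ > 0` and a sequence of polynomial functions `P_j` with
`‖f - P_j‖_{ρ,K}^M → 0`. -/
theorem polynomials_dense_in_CM
    (n : ℕ) (M : ℕ → ℝ) (hM : DCWeightSeq M)
    (U : Set (Fin n → ℝ)) (hU : IsOpen U)
    (f : (Fin n → ℝ) → ℝ) (hf : CMClassOn M U f)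
    (K : Set (Fin n → ℝ)) (hK : IsCompact K) (hKU : K ⊆ U) :
    ∃ ρ > (0 : ℝ), ∃ fseq : ℕ → (Fin n → ℝ) → ℝ,
      (∀ j : ℕ, ∃ P : MvPolynomial (Fin n) ℝ,
        ∀ x : Fin n → ℝ, fseq j x = MvPolynomial.eval x P) ∧
      Filter.Tendsto (fun j => CMNorm M ρ U K (f - fseq j)) Filter.atTop (nhds 0) := by
  obtain ⟨σ, hσ, B, hB, h⟩ :=
    hf.exists_mvPolynomial_norm_iteratedFDerivWithin_sub_le hM hU hK hKU
  choose P hP using fun j : ℕ => h (1 / ((j : ℝ) + 1)) Nat.one_div_pos_of_nat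
  refine ⟨σ, hσ, fun j x => MvPolynomial.eval x (P j), fun j => ⟨P j, fun _ => rfl⟩, ?_⟩
  have hlim : Filter.Tendsto (fun j : ℕ => ENNReal.ofReal (1 / ((j : ℝ) + 1) * B)) Filter.atTop
      (nhds 0) := by
    have := ENNReal.tendsto_ofReal (tendsto_one_div_add_atTop_nhds_zero_nat.mul_const B)
    simpa using this
  refine tendsto_of_tendsto_of_tendsto_of_le_of_le tendsto_const_nhds hlim (fun _ => zero_le)
    fun j => iSup_le fun k => iSup_le fun x => iSup_le fun hx => ENNReal.ofReal_le_ofReal ?_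
  have := hM.2.1 k
  rw [div_le_iff₀ (by positivity)]
  exact hP j k x hx
end

section
/- Let M be a DC-weight sequence and let ψ = φ_1^{p_1}···φ_l^{p_l} be a finite product of powers of nonzero linear forms φ_1,…,φ_l on ℝ^n (p_1,…,p_l ≥ 1). Then the principal ideal ψ·C^M(ℝ^n) is sequentially closed in C^M(ℝ^n): if f ∈ C^M(ℝ^n) and (g_j) is a sequence in C^M(ℝ^n) such that for every compact K ⊆ ℝ^n there exists ρ > 0 with ‖ψ·g_j − f‖_{ρ,K}^M → 0 as j → ∞, then there exists g ∈ C^M(ℝ^n) with f = ψ·g. -/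
open scoped Nat ENNReal
open Matrix

section ParametricIntegral

universe u

variable {E F : Type u} [NormedAddCommGroup E] [NormedSpace ℝ E]
  [NormedAddCommGroup F] [NormedSpace ℝ F]

theorem contDiff_fderiv_of_uncurry {Φ : ℝ → E → F}
    (hΦ : ContDiff ℝ (⊤ : ℕ∞) (fun q : ℝ × E => Φ q.1 q.2)) :
    ContDiff ℝ (⊤ : ℕ∞) (fun q : ℝ × E => fderiv ℝ (Φ q.1) q.2) := by
  refine ContDiff.fderiv (f := fun q : ℝ × E => Φ q.1) (g := fun q => q.2) (n := (⊤ : ℕ∞))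
    (m := (⊤ : ℕ∞)) ?_ contDiff_snd (by simp)
  exact hΦ.comp ((contDiff_fst.comp contDiff_fst).prodMk contDiff_snd)

theorem hasFDerivAt_intervalIntegral_of_contDiff [FiniteDimensional ℝ E] {Φ : ℝ → E → F}
    (hΦ : ContDiff ℝ (⊤ : ℕ∞) (fun q : ℝ × E => Φ q.1 q.2)) (x : E) :
    HasFDerivAt (fun y => ∫ t in (0 : ℝ)..1, Φ t y)
      (∫ t in (0 : ℝ)..1, fderiv ℝ (Φ t) x) x := by
  have hD := (contDiff_fderiv_of_uncurry hΦ).continuous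
  have hc (y : E) : Continuous (fun t => Φ t y) :=
    hΦ.continuous.comp (continuous_id.prodMk continuous_const)
  have hDc (y : E) : Continuous (fun t => fderiv ℝ (Φ t) y) :=
    hD.comp (continuous_id.prodMk continuous_const)
  have : ProperSpace E := FiniteDimensional.proper_real E
  obtain ⟨B, hB⟩ := (isCompact_Icc (a := (0 : ℝ)) (b := 1)).prod
    (isCompact_closedBall x 1) |>.exists_bound_of_continuousOn hD.continuousOn
  refine intervalIntegral.hasFDerivAt_integral_of_dominated_of_fderiv_le
    (F' := fun y t => fderiv ℝ (Φ t) y) (bound := fun _ => B)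
    (Metric.closedBall_mem_nhds x one_pos)
    (Filter.Eventually.of_forall fun y => (hc y).aestronglyMeasurable)
    ((hc x).intervalIntegrable _ _) (hDc x).aestronglyMeasurable ?_
    intervalIntegrable_const ?_
  · refine Filter.Eventually.of_forall fun t ht y hy => hB (t, y) ⟨?_, hy⟩
    rw [Set.uIoc_of_le zero_le_one] at ht
    exact ⟨ht.1.le, ht.2⟩
  · refine Filter.Eventually.of_forall fun t _ y _ => ?_
    have : ContDiff ℝ (⊤ : ℕ∞) (Φ t) := hΦ.comp (contDiff_const.prodMk contDiff_id)
    exact (this.differentiable (by simp) y).hasFDerivAt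

theorem contDiff_intervalIntegral_of_contDiff [FiniteDimensional ℝ E] {Φ : ℝ → E → F}
    (hΦ : ContDiff ℝ (⊤ : ℕ∞) (fun q : ℝ × E => Φ q.1 q.2)) :
    ContDiff ℝ (⊤ : ℕ∞) (fun y => ∫ t in (0 : ℝ)..1, Φ t y) := by
  refine contDiff_infty.2 fun n => ?_
  induction n generalizing F with
  | zero =>
    exact contDiff_zero.2 (continuous_iff_continuousAt.2 fun x =>
      (hasFDerivAt_intervalIntegral_of_contDiff hΦ x).continuousAt)
  | succ n ih =>
    push_cast
    refine contDiff_succ_iff_fderiv.2 ⟨fun x =>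
      (hasFDerivAt_intervalIntegral_of_contDiff hΦ x).differentiableAt, by simp, ?_⟩
    rw [funext fun x => (hasFDerivAt_intervalIntegral_of_contDiff hΦ x).fderiv]
    exact ih (contDiff_fderiv_of_uncurry hΦ)

theorem norm_iteratedFDeriv_intervalIntegral_le [FiniteDimensional ℝ E] {Φ : ℝ → E → F}
    (hΦ : ContDiff ℝ (⊤ : ℕ∞) (fun q : ℝ × E => Φ q.1 q.2)) (k : ℕ) (x : E) (B : ℝ)
    (hB : ∀ t ∈ Set.Icc (0 : ℝ) 1, ‖iteratedFDeriv ℝ k (Φ t) x‖ ≤ B) :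
    ‖iteratedFDeriv ℝ k (fun y => ∫ t in (0 : ℝ)..1, Φ t y) x‖ ≤ B := by
  induction k generalizing F with
  | zero =>
    simp only [norm_iteratedFDeriv_zero] at hB ⊢
    refine (intervalIntegral.norm_integral_le_of_norm_le_const fun t ht => ?_).trans
      (by simp : B * |(1 : ℝ) - 0| ≤ B)
    rw [Set.uIoc_of_le zero_le_one] at ht
    exact hB t ⟨ht.1.le, ht.2⟩
  | succ k ih =>
    rw [← norm_iteratedFDeriv_fderiv,
      funext fun x => (hasFDerivAt_intervalIntegral_of_contDiff hΦ x).fderiv]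
    refine ih (contDiff_fderiv_of_uncurry hΦ) fun t ht => ?_
    rw [norm_iteratedFDeriv_fderiv]
    exact hB t ht

end ParametricIntegral

section Division

variable {E : Type} [NormedAddCommGroup E] [NormedSpace ℝ E]

/-- The mean of the derivative of `F` in direction `e` over the segment from `x` to
`x - ℓ x • e`; when `ℓ e = 1` this is the quotient `F / ℓ` for `F` vanishing on `ker ℓ`. -/
noncomputable def hadamardQuotient (ℓ : E →L[ℝ] ℝ) (e : E) (F : E → ℝ) (x : E) : ℝ :=
  ∫ t in (0 : ℝ)..1, fderiv ℝ F (x - (t * ℓ x) • e) e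

theorem contDiff_hadamardQuotient_integrand (ℓ : E →L[ℝ] ℝ) (e : E) {F : E → ℝ}
    (hF : ContDiff ℝ (⊤ : ℕ∞) F) :
    ContDiff ℝ (⊤ : ℕ∞) (fun q : ℝ × E => fderiv ℝ F (q.2 - (q.1 * ℓ q.2) • e) e) := by
  have h1 : ContDiff ℝ (⊤ : ℕ∞) (fderiv ℝ F) := (contDiff_infty_iff_fderiv.1 hF).2
  refine ContDiff.clm_apply (h1.comp ?_) contDiff_const
  fun_prop

theorem contDiff_hadamardQuotient [FiniteDimensional ℝ E] (ℓ : E →L[ℝ] ℝ) (e : E) {F : E → ℝ}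
    (hF : ContDiff ℝ (⊤ : ℕ∞) F) : ContDiff ℝ (⊤ : ℕ∞) (hadamardQuotient ℓ e F) :=
  contDiff_intervalIntegral_of_contDiff (contDiff_hadamardQuotient_integrand ℓ e hF)

theorem mul_hadamardQuotient (ℓ : E →L[ℝ] ℝ) (e : E) {F : E → ℝ}
    (hF : ContDiff ℝ (⊤ : ℕ∞) F) (x : E) :
    ℓ x * hadamardQuotient ℓ e F x = F x - F (x - ℓ x • e) := by
  have hd (t : ℝ) : HasDerivAt (fun t : ℝ => F (x - (t * ℓ x) • e))
      (-(ℓ x * fderiv ℝ F (x - (t * ℓ x) • e) e)) t := by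
    have h1 : HasDerivAt (fun t : ℝ => x - (t * ℓ x) • e) (-(ℓ x • e)) t := by
      simpa using (((hasDerivAt_id t).mul_const (ℓ x)).smul_const e).const_sub x
    have h2 := ((hF.differentiable (by simp) (x - (t * ℓ x) • e)).hasFDerivAt).comp_hasDerivAt t h1
    simpa [Function.comp_def] using h2
  have hc : Continuous fun t : ℝ => fderiv ℝ F (x - (t * ℓ x) • e) e :=
    (contDiff_hadamardQuotient_integrand ℓ e hF).continuous.comp
      (continuous_id.prodMk continuous_const)
  have := intervalIntegral.integral_eq_sub_of_hasDerivAt (a := 0) (b := 1) (fun t _ => hd t)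
    ((continuous_const.mul hc).neg.intervalIntegrable _ _)
  rw [intervalIntegral.integral_neg, intervalIntegral.integral_const_mul] at this
  simp only [one_mul, zero_mul, zero_smul, sub_zero] at this
  rw [hadamardQuotient]
  linarith

theorem norm_iteratedFDeriv_hadamardQuotient_le [FiniteDimensional ℝ E] (ℓ : E →L[ℝ] ℝ) (e : E) {F : E → ℝ}
    (hF : ContDiff ℝ (⊤ : ℕ∞) F) (k : ℕ) (x : E) (B : ℝ)
    (hB : ∀ t ∈ Set.Icc (0 : ℝ) 1, ‖iteratedFDeriv ℝ (k + 1) F (x - (t * ℓ x) • e)‖ ≤ B) :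
    ‖iteratedFDeriv ℝ k (hadamardQuotient ℓ e F) x‖ ≤ ‖e‖ * (1 + ‖ℓ‖ * ‖e‖) ^ k * B := by
  refine norm_iteratedFDeriv_intervalIntegral_le
    (contDiff_hadamardQuotient_integrand ℓ e hF) k x _ fun t ht => ?_
  let A : E →L[ℝ] E := ContinuousLinearMap.id ℝ E - t • ℓ.smulRight e
  have hA : ‖A‖ ≤ 1 + ‖ℓ‖ * ‖e‖ := by
    refine (norm_sub_le _ _).trans ?_
    gcongr
    · exact ContinuousLinearMap.norm_id_le
    rw [norm_smul, ContinuousLinearMap.norm_smulRight_apply, Real.norm_of_nonneg ht.1]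
    exact mul_le_of_le_one_left (by positivity) ht.2
  have hAx (y : E) : A y = y - (t * ℓ y) • e := by simp [A, smul_smul]
  have h1 : ContDiff ℝ (⊤ : ℕ∞) (fderiv ℝ F) := (contDiff_infty_iff_fderiv.1 hF).2
  have hfun : (fun y => fderiv ℝ F (y - (t * ℓ y) • e) e) =
      fun y => ((fderiv ℝ F ∘ A) y) e := by
    ext y; simp [hAx]
  have hk : (k : WithTop ℕ∞) ≤ ((⊤ : ℕ∞) : WithTop ℕ∞) := mod_cast le_top
  rw [hfun]
  refine (norm_iteratedFDeriv_clm_apply_const (h1.comp A.contDiff).contDiffAt hk).trans ?_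
  rw [A.iteratedFDeriv_comp_right h1 x hk, mul_assoc]
  refine mul_le_mul_of_nonneg_left ?_ (norm_nonneg e)
  refine (ContinuousMultilinearMap.norm_compContinuousLinearMap_le _ _).trans ?_
  rw [norm_iteratedFDeriv_fderiv, hAx, mul_comm, Finset.prod_const, Finset.card_univ,
    Fintype.card_fin]
  exact mul_le_mul (pow_le_pow_left₀ (norm_nonneg _) hA k) (hB t ht) (norm_nonneg _)
    (by positivity)

theorem dense_ne_zero_of_ne_zero {ℓ : E →L[ℝ] ℝ} {e : E} (he : ℓ e = 1) :
    Dense {x : E | ℓ x ≠ 0} := by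
  intro x
  have h : Filter.Tendsto (fun t : ℝ => x + t • e) (nhdsWithin 0 {0}ᶜ) (nhds x) := by
    have : Continuous fun t : ℝ => x + t • e := by fun_prop
    simpa using (this.tendsto 0).mono_left nhdsWithin_le_nhds
  refine mem_closure_of_frequently_of_tendsto (Filter.Eventually.frequently ?_) h
  by_cases hx : ℓ x = 0
  · filter_upwards [self_mem_nhdsWithin] with t ht
    simpa [hx, he] using ht
  · have : Continuous fun t : ℝ => ℓ (x + t • e) := by fun_prop
    exact nhdsWithin_le_nhds ((this.tendsto 0).eventually_ne (by simpa using hx))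

theorem eq_hadamardQuotient_of_eq_mul [FiniteDimensional ℝ E] {ℓ : E →L[ℝ] ℝ} {e : E} (he : ℓ e = 1) {F H : E → ℝ}
    (hF : ContDiff ℝ (⊤ : ℕ∞) F) (hH : Continuous H) (hFH : ∀ x, F x = ℓ x * H x) :
    H = hadamardQuotient ℓ e F := by
  refine hH.ext_on (dense_ne_zero_of_ne_zero he) (contDiff_hadamardQuotient ℓ e hF).continuous
    fun x hx => mul_left_cancel₀ hx ?_
  rw [mul_hadamardQuotient ℓ e hF, hFH, hFH (x - ℓ x • e)]
  simp [he]

theorem isCompact_image_segment (ℓ : E →L[ℝ] ℝ) (e : E) {K : Set E} (hK : IsCompact K) :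
    IsCompact ((fun q : ℝ × E => q.2 - (q.1 * ℓ q.2) • e) '' (Set.Icc 0 1 ×ˢ K)) :=
  (isCompact_Icc.prod hK).image (by fun_prop)

theorem DCWeightSeq.exists_succ_le {M : ℕ → ℝ} (hM : DCWeightSeq M) :
    ∃ A > (0 : ℝ), ∃ B > (0 : ℝ), ∀ k, M (k + 1) ≤ A * B ^ k * M k := by
  obtain ⟨h0, hpos, -, -, C, hC⟩ := hM
  refine ⟨max 1 (M 1), by positivity, max 1 C, by positivity, fun k => ?_⟩
  have hk := hpos k
  rcases Nat.eq_zero_or_pos k with rfl | hk1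
  · simp [h0]
  · have hr : 0 ≤ M (k + 1) / M k := (div_pos (hpos _) hk).le
    have h1 : M (k + 1) / M k ≤ (max 1 C) ^ k := by
      calc M (k + 1) / M k = ((M (k + 1) / M k) ^ ((1 : ℝ) / k)) ^ k := by
            rw [one_div, Real.rpow_inv_natCast_pow hr hk1.ne']
        _ ≤ (max 1 C) ^ k :=
            pow_le_pow_left₀ (Real.rpow_nonneg hr _) ((hC k hk1).trans (le_max_right _ _)) k
    rw [div_le_iff₀ hk] at h1
    refine h1.trans (mul_le_mul_of_nonneg_right ?_ hk.le)
    exact le_mul_of_one_le_left (by positivity) (le_max_left _ _)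

theorem CMClassOn.contDiff {M : ℕ → ℝ} {F : E → ℝ} (hF : CMClassOn M Set.univ F) :
    ContDiff ℝ (⊤ : ℕ∞) F :=
  contDiffOn_univ.1 hF.1

theorem CMClassOn.hadamardQuotient [FiniteDimensional ℝ E] {M : ℕ → ℝ} (hM : DCWeightSeq M) (ℓ : E →L[ℝ] ℝ) {e : E}
    (he : e ≠ 0) {F : E → ℝ} (hF : CMClassOn M Set.univ F) :
    CMClassOn M Set.univ (hadamardQuotient ℓ e F) := by
  refine ⟨contDiffOn_univ.2 (contDiff_hadamardQuotient ℓ e hF.contDiff), fun K _ hK => ?_⟩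
  obtain ⟨C, hC, ρ, hρ, hb⟩ := hF.2 _ (Set.subset_univ _) (isCompact_image_segment ℓ e hK)
  obtain ⟨A, hA, B, hB, hAB⟩ := hM.exists_succ_le
  have he' : 0 < ‖e‖ := norm_pos_iff.2 he
  simp only [iteratedFDerivWithin_univ] at hb ⊢
  refine ⟨‖e‖ * C * ρ * A, by positivity, (1 + ‖ℓ‖ * ‖e‖) * ρ * 2 * B, by positivity,
    fun k x hx => ?_⟩
  refine (norm_iteratedFDeriv_hadamardQuotient_le ℓ e hF.contDiff k x _
    fun t ht => hb (k + 1) _ ⟨(t, x), ⟨ht, hx⟩, rfl⟩).trans ?_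
  have h2 : ((k : ℝ) + 1) ≤ 2 ^ k := mod_cast Nat.lt_two_pow_self (n := k)
  have hMk := hM.2.1 k
  have hMk' := hM.2.1 (k + 1)
  calc ‖e‖ * (1 + ‖ℓ‖ * ‖e‖) ^ k * (C * ρ ^ (k + 1) * ((k + 1)! : ℝ) * M (k + 1))
      = ‖e‖ * (1 + ‖ℓ‖ * ‖e‖) ^ k * (C * ρ ^ (k + 1) * (((k : ℝ) + 1) * (k ! : ℝ)) * M (k + 1)) := by
        push_cast [Nat.factorial_succ]; ring
    _ ≤ ‖e‖ * (1 + ‖ℓ‖ * ‖e‖) ^ k *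
        (C * ρ ^ (k + 1) * (2 ^ k * (k ! : ℝ)) * (A * B ^ k * M k)) := by
        gcongr
        exact hAB k
    _ = _ := by rw [mul_pow, mul_pow, mul_pow]; ring

/-- Convergence to zero of all derivatives, uniformly on compact sets. -/
def SmoothTendstoZero (H : ℕ → E → ℝ) : Prop :=
  ∀ K : Set E, IsCompact K → ∀ k : ℕ, ∀ ε > (0 : ℝ), ∀ᶠ j in Filter.atTop,
    ∀ x ∈ K, ‖iteratedFDeriv ℝ k (H j) x‖ ≤ ε

theorem SmoothTendstoZero.tendsto {H : ℕ → E → ℝ} (hH : SmoothTendstoZero H) (x : E) :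
    Filter.Tendsto (fun j => H j x) Filter.atTop (nhds 0) := by
  refine Metric.nhds_basis_closedBall.tendsto_right_iff.2 fun ε hε => ?_
  filter_upwards [hH {x} isCompact_singleton 0 ε hε] with j hj
  simpa using hj x rfl

theorem SmoothTendstoZero.hadamardQuotient [FiniteDimensional ℝ E] (ℓ : E →L[ℝ] ℝ) (e : E) {H : ℕ → E → ℝ}
    (hs : ∀ j, ContDiff ℝ (⊤ : ℕ∞) (H j)) (hH : SmoothTendstoZero H) :
    SmoothTendstoZero fun j => hadamardQuotient ℓ e (H j) := by
  intro K hK k ε hε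
  set c : ℝ := ‖e‖ * (1 + ‖ℓ‖ * ‖e‖) ^ k with hc
  have hc0 : 0 ≤ c := by positivity
  filter_upwards [hH _ (isCompact_image_segment ℓ e hK) (k + 1) (ε / (c + 1)) (by positivity)]
    with j hj x hx
  refine (norm_iteratedFDeriv_hadamardQuotient_le ℓ e (hs j) k x _
    fun t ht => hj _ ⟨(t, x), ⟨ht, hx⟩, rfl⟩).trans ?_
  rw [← hc, mul_div_assoc', div_le_iff₀ (by positivity)]
  nlinarith

/-- `ψ` is smooth, and whenever `ψ · g j` converges to `f` of class `C^M` together with all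
derivatives, `f` is divisible by `ψ` in `C^M` and `g j` converges to the quotient. -/
def HasClosedDivision (M : ℕ → ℝ) (ψ : E → ℝ) : Prop :=
  ContDiff ℝ (⊤ : ℕ∞) ψ ∧
    ∀ f : E → ℝ, CMClassOn M Set.univ f → ∀ g : ℕ → E → ℝ,
      (∀ j, ContDiff ℝ (⊤ : ℕ∞) (g j)) → SmoothTendstoZero (fun j => ψ * g j - f) →
      ∃ h : E → ℝ, CMClassOn M Set.univ h ∧ f = ψ * h ∧ SmoothTendstoZero (fun j => g j - h)

theorem HasClosedDivision.one (M : ℕ → ℝ) : HasClosedDivision M (1 : E → ℝ) :=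
  ⟨contDiff_const, fun f hf g _ h => ⟨f, hf, by simp, by simpa using h⟩⟩

theorem HasClosedDivision.mul {M : ℕ → ℝ} {ψ₁ ψ₂ : E → ℝ} (h₁ : HasClosedDivision M ψ₁)
    (h₂ : HasClosedDivision M ψ₂) : HasClosedDivision M (ψ₁ * ψ₂) := by
  refine ⟨h₁.1.mul h₂.1, fun f hf g hg h => ?_⟩
  obtain ⟨f₁, hf₁, rfl, hc₁⟩ := h₁.2 f hf (fun j => ψ₂ * g j) (fun j => h₂.1.mul (hg j))
    (by simpa only [mul_assoc] using h)
  obtain ⟨f₂, hf₂, rfl, hc₂⟩ := h₂.2 f₁ hf₁ g hg hc₁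
  exact ⟨f₂, hf₂, (mul_assoc _ _ _).symm, hc₂⟩

theorem HasClosedDivision.pow {M : ℕ → ℝ} {ψ : E → ℝ} (h : HasClosedDivision M ψ) (m : ℕ) :
    HasClosedDivision M (ψ ^ m) := by
  induction m with
  | zero => simpa using HasClosedDivision.one M
  | succ m ih => rw [pow_succ]; exact ih.mul h

theorem hasClosedDivision_linearForm [FiniteDimensional ℝ E] {M : ℕ → ℝ} (hM : DCWeightSeq M) {ℓ : E →L[ℝ] ℝ}
    (hℓ : ℓ ≠ 0) : HasClosedDivision M (ℓ : E → ℝ) := by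
  refine ⟨ℓ.contDiff, fun f hf g hg h => ?_⟩
  obtain ⟨v, hv⟩ : ∃ v, ℓ v ≠ 0 := by
    by_contra! hv
    exact hℓ (ContinuousLinearMap.ext hv)
  obtain ⟨e, he⟩ : ∃ e, ℓ e = 1 := ⟨(ℓ v)⁻¹ • v, by simp [hv]⟩
  have he0 : e ≠ 0 := by rintro rfl; simp at he
  have hzero (x : E) (hx : ℓ x = 0) : f x = 0 := by
    have := h.tendsto x
    simp only [Pi.sub_apply, Pi.mul_apply, hx, zero_mul, zero_sub] at this
    simpa using tendsto_nhds_unique this tendsto_const_nhds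
  have hdiv (x : E) : f x = ℓ x * hadamardQuotient ℓ e f x := by
    rw [mul_hadamardQuotient ℓ e hf.contDiff, hzero (x - ℓ x • e) (by simp [he]), sub_zero]
  have hq := hf.hadamardQuotient hM ℓ he0
  have hs (j : ℕ) : ContDiff ℝ (⊤ : ℕ∞) (⇑ℓ * g j - f) := (ℓ.contDiff.mul (hg j)).sub hf.contDiff
  refine ⟨hadamardQuotient ℓ e f, hq, funext hdiv, ?_⟩
  have heq : (fun j => g j - hadamardQuotient ℓ e f) =
      fun j => hadamardQuotient ℓ e (⇑ℓ * g j - f) := by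
    funext j
    refine eq_hadamardQuotient_of_eq_mul he (hs j)
      ((hg j).continuous.sub hq.contDiff.continuous) fun x => ?_
    simp only [Pi.sub_apply, Pi.mul_apply]
    rw [mul_sub, ← hdiv]
  rw [heq]
  exact h.hadamardQuotient ℓ e hs

theorem smoothTendstoZero_of_tendsto_CMNorm {M : ℕ → ℝ} (hM : DCWeightSeq M) {H : ℕ → E → ℝ}
    (h : ∀ K : Set E, IsCompact K → ∃ ρ > (0 : ℝ),
      Filter.Tendsto (fun j => CMNorm M ρ Set.univ K (H j)) Filter.atTop (nhds 0)) :
    SmoothTendstoZero H := by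
  intro K hK k ε hε
  obtain ⟨ρ, hρ, ht⟩ := h K hK
  have hMk := hM.2.1 k
  have hw : 0 < ρ ^ k * (k ! : ℝ) * M k := by positivity
  have hpos : (0 : ℝ≥0∞) < ENNReal.ofReal (ε / (ρ ^ k * (k ! : ℝ) * M k)) := by
    rw [ENNReal.ofReal_pos]; positivity
  filter_upwards [ht.eventually_lt_const hpos] with j hj x hx
  have hle : ENNReal.ofReal (‖iteratedFDerivWithin ℝ k (H j) Set.univ x‖ /
      (ρ ^ k * (k ! : ℝ) * M k)) ≤ CMNorm M ρ Set.univ K (H j) :=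
    le_iSup_of_le k (le_iSup₂_of_le x hx le_rfl)
  have := (ENNReal.ofReal_le_ofReal_iff (by positivity)).1 (hle.trans hj.le)
  rwa [div_le_div_iff_of_pos_right hw, iteratedFDerivWithin_univ] at this

end Division

/-- Let `ψ = L₁^{p₁} ⋯ L_l^{p_l}` be a finite product of powers of nonzero
linear forms on `ℝⁿ`.  Then the principal ideal `ψ · C^M(ℝⁿ)` is sequentially closed in
`C^M(ℝⁿ)`. -/
theorem CM_principal_ideal_of_product_of_linear_forms_closed
    (n l : ℕ) (M : ℕ → ℝ) (hM : DCWeightSeq M)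
    (L : Fin l → ((Fin n → ℝ) →ₗ[ℝ] ℝ)) (hL : ∀ i, L i ≠ 0)
    (p : Fin l → ℕ) (hp : ∀ i, 1 ≤ p i)
    (f : (Fin n → ℝ) → ℝ) (hf : CMClassOn M Set.univ f)
    (g : ℕ → (Fin n → ℝ) → ℝ) (hg : ∀ j, CMClassOn M Set.univ (g j))
    (hconv : ∀ K : Set (Fin n → ℝ), IsCompact K → ∃ ρ > (0 : ℝ),
      Filter.Tendsto
        (fun j => CMNorm M ρ Set.univ K
          ((fun x => (∏ i, L i x ^ p i) * g j x) - f)) Filter.atTop (nhds 0)) :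
    ∃ h : (Fin n → ℝ) → ℝ, CMClassOn M Set.univ h ∧
      ∀ x, f x = (∏ i, L i x ^ p i) * h x := by
  have hψ : HasClosedDivision M (∏ i, (fun x => L i x) ^ p i) := by
    refine Finset.prod_induction _ (HasClosedDivision M) (fun _ _ => HasClosedDivision.mul)
      (HasClosedDivision.one M) fun i _ => ?_
    refine (hasClosedDivision_linearForm hM (ℓ := LinearMap.toContinuousLinearMap (L i))
      ?_).pow (p i)
    simpa using hL i
  have heq : (∏ i, (fun x => L i x) ^ p i) = fun x => ∏ i, L i x ^ p i := by
    ext x; simp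
  rw [heq] at hψ
  obtain ⟨h, hh, hfh, -⟩ := hψ.2 f hf g (fun j => (hg j).contDiff)
    (smoothTendstoZero_of_tendsto_CMNorm hM hconv)
  exact ⟨h, hh, congrFun hfh⟩
end
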